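/- The time-reversed coalescent process (X_{T−j})_{0 ≤ j ≤ T} is a Markov chain, and its transitions are given by a one-step parent-collision experiment: for every 1 ≤ j ≤ T and all positive integers m_{j−1}, m_j, m_{j+1}, …, m_T such that the event {X_i = m_i for all j ≤ i ≤ T} has positive probability, P(X_{j−1} = m_{j−1} | X_i = m_i for all j ≤ i ≤ T) = P(X_{j−1} = m_{j−1} | X_j = m_j), and this conditional probability equals P(#{𝔭'(w_1), …, 𝔭'(w_{m_j})} = m_{j−1}), where ν' is a random vector distributed as ν^{j−1}, 𝔭' : {1,…,q(j)} → {1,…,q(j−1)} is the consecutive-block parent map associated with ν', and (w_1, …, w_{m_j}) is a uniformly random tuple of distinct elements of {1,…,q(j)}, independent of ν'. -/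

import Mathlib

open MeasureTheory Finset
open scoped ENNReal

/-- The parent map associated with an offspring vector `v`: individuals `0, 1, …` of the
next generation are partitioned into consecutive blocks of sizes `v 0, v 1, …`, and
`parentMap v c` is the index of the block containing individual `c`. -/
noncomputable def parentMap (v : ℕ → ℕ) (c : ℕ) : ℕ :=
  sInf {i : ℕ | c < ∑ j ∈ Finset.range (i + 1), v j}

/-- The value of a permutation of `Fin M` at position `i < M`, and `0` otherwise. -/
def permVal {M : ℕ} (e : Equiv.Perm (Fin M)) (i : ℕ) : ℕ :=
  if h : i < M then (e ⟨i, h⟩ : Fin M) else 0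

/-- `ancTo fam j s c` is the ancestor at height `j` of the individual `c` living at
height `s` (for `j ≤ s`), obtained by composing the parent maps
`parentMap (fam (s-1)), …, parentMap (fam j)`; it is `c` itself when `s ≤ j`. -/
noncomputable def ancTo (fam : ℕ → ℕ → ℕ) (j : ℕ) : ℕ → ℕ → ℕ
  | 0, c => c
  | s + 1, c => if j ≤ s then ancTo fam j s (parentMap (fam s) c) else c

/-- The coalescent process: `coalX q T k fam e j` is the number of distinct ancestors at
height `j` of the `k` individuals `e 0, …, e (k-1)` at height `T`. -/
noncomputable def coalX (q : ℕ → ℕ) (T k : ℕ) (fam : ℕ → ℕ → ℕ)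
    (e : Equiv.Perm (Fin (q T))) (j : ℕ) : ℕ :=
  ((Finset.range k).image (fun i => ancTo fam j T (permVal e i))).card

theorem fiber_perm {β : Type*} [DecidableEq β] (s : Finset ℕ) (f g : ℕ → β)
    (h : ∀ b, (s.filter (fun c => f c = b)).card = (s.filter (fun c => g c = b)).card) :
    ∃ ρ : Equiv.Perm ℕ, (∀ c, ρ c ∈ s ↔ c ∈ s) ∧ ∀ c ∈ s, f (ρ c) = g c := by
  classical
  have key : ∀ b, Nonempty ({x : {x // x ∈ s} // g x = b} ≃ {x : {x // x ∈ s} // f x = b}) := by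
    intro b
    refine Fintype.card_eq.mp ?_
    have h1 : ∀ F : ℕ → β, Fintype.card {x : {x // x ∈ s} // F x = b}
        = (s.filter (fun c => F c = b)).card := by
      intro F
      rw [← Fintype.card_coe]
      refine Fintype.card_congr ⟨fun x => ⟨x.1.1, Finset.mem_filter.mpr ⟨x.1.2, x.2⟩⟩,
        fun x => ⟨⟨x.1, (Finset.mem_filter.mp x.2).1⟩, (Finset.mem_filter.mp x.2).2⟩,
        fun x => rfl, fun x => rfl⟩
    rw [h1, h1, h b]
  let e0 : {x // x ∈ s} ≃ {x // x ∈ s} :=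
    (Equiv.sigmaFiberEquiv (fun x : {x // x ∈ s} => g x)).symm.trans
      ((Equiv.sigmaCongrRight (fun b => (key b).some)).trans
        (Equiv.sigmaFiberEquiv (fun x : {x // x ∈ s} => f x)))
  have he0 : ∀ x, f (e0 x) = g x := by
    intro x
    exact ((key (g x)).some ⟨x, rfl⟩).2
  refine ⟨Equiv.Perm.ofSubtype e0, ?_, ?_⟩
  · intro c
    by_cases hc : c ∈ s
    · rw [Equiv.Perm.ofSubtype_apply_of_mem _ hc]; simp [hc]
    · rw [Equiv.Perm.ofSubtype_apply_of_not_mem _ hc]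
  · intro c hc
    rw [Equiv.Perm.ofSubtype_apply_of_mem _ hc]
    exact he0 ⟨c, hc⟩

theorem parentMap_eq_iff (v : ℕ → ℕ) (q Q c i : ℕ) (hs : ∑ a ∈ Finset.range q, v a = Q)
    (hc : c < Q) :
    parentMap v c = i ↔ (∑ a ∈ Finset.range i, v a ≤ c ∧ c < ∑ a ∈ Finset.range (i+1), v a) := by
  have hmono : Monotone (fun n => ∑ a ∈ Finset.range n, v a) := by
    intro a b hab
    exact Finset.sum_le_sum_of_subset (Finset.range_mono hab)
  have hne : {i : ℕ | c < ∑ j ∈ Finset.range (i + 1), v j}.Nonempty := by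
    refine ⟨q, ?_⟩
    have := hmono (Nat.le_succ q)
    simp only [Set.mem_ofPred_eq] at this ⊢
    exact lt_of_lt_of_le (hs ▸ hc) this
  constructor
  · intro h
    have h1 := Nat.sInf_mem hne
    rw [show sInf {i : ℕ | c < ∑ j ∈ Finset.range (i + 1), v j} = i from h] at h1
    refine ⟨?_, h1⟩
    rcases i with _ | i
    · simp
    · have : i < sInf {i : ℕ | c < ∑ j ∈ Finset.range (i + 1), v j} := by
        change i < parentMap v c
        omega
      have := Nat.notMem_of_lt_sInf this
      simpa using this
  · rintro ⟨h1, h2⟩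
    apply le_antisymm
    · exact Nat.sInf_le h2
    · by_contra hlt
      push Not at hlt
      have h3 := Nat.sInf_mem hne
      have h4 := hmono (show parentMap v c + 1 ≤ i from hlt)
      have h5 : c < ∑ a ∈ Finset.range (parentMap v c + 1), v a := h3
      simp only at h4
      omega

theorem parentMap_lt (v : ℕ → ℕ) (q Q c : ℕ) (hs : ∑ a ∈ Finset.range q, v a = Q)
    (hc : c < Q) : parentMap v c < q := by
  have h := ((parentMap_eq_iff v q Q c _ hs hc).mp rfl).1
  by_contra hlt
  push Not at hlt
  have : ∑ a ∈ Finset.range q, v a ≤ ∑ a ∈ Finset.range (parentMap v c), v a :=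
    Finset.sum_le_sum_of_subset (Finset.range_mono hlt)
  omega

theorem parentMap_fiber (v : ℕ → ℕ) (q Q i : ℕ) (hs : ∑ a ∈ Finset.range q, v a = Q) :
    ((Finset.range Q).filter (fun c => parentMap v c = i)).card = if i < q then v i else 0 := by
  split_ifs with hi
  · have h : (Finset.range Q).filter (fun c => parentMap v c = i)
        = Finset.Ico (∑ a ∈ Finset.range i, v a) (∑ a ∈ Finset.range (i+1), v a) := by
      ext c
      simp only [Finset.mem_filter, Finset.mem_range, Finset.mem_Ico]
      constructor
      · rintro ⟨h1, h2⟩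
        exact (parentMap_eq_iff v q Q c i hs h1).mp h2
      · intro h
        have : ∑ a ∈ Finset.range (i+1), v a ≤ ∑ a ∈ Finset.range q, v a :=
          Finset.sum_le_sum_of_subset (Finset.range_mono hi)
        have hc : c < Q := by omega
        exact ⟨hc, (parentMap_eq_iff v q Q c i hs hc).mpr h⟩
    rw [h, Nat.card_Ico, Finset.sum_range_succ]; omega
  · rw [Finset.card_eq_zero, Finset.filter_eq_empty_iff]
    intro c hc h
    exact hi (h ▸ parentMap_lt v q Q c hs (Finset.mem_range.mp hc))

/-- pointwise symmetry -/
theorem pointwise_sym (v v' : ℕ → ℕ) (q Q : ℕ) (hs : ∑ a ∈ Finset.range q, v a = Q)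
    (π : Equiv.Perm ℕ) (hπ : ∀ c, π c ∈ Finset.range q ↔ c ∈ Finset.range q)
    (hv : ∀ n ∈ Finset.range q, v' n = v (π n))
    (f : Finset ℕ → ℝ≥0∞)
    (hf : ∀ C C', C ⊆ Finset.range Q → C' ⊆ Finset.range Q → C.card = C'.card → f C = f C')
    (B : Finset ℕ) :
    ∑ C ∈ (Finset.range Q).powerset, f C * (if C.image (parentMap v') = B then 1 else 0)
    = ∑ C ∈ (Finset.range Q).powerset,
        f C * (if C.image (parentMap v) = B.image π then 1 else 0) := by
  have hs' : ∑ a ∈ Finset.range q, v' a = Q := by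
    rw [← hs]
    exact Finset.sum_equiv π (fun i => (hπ i).symm) (fun i hi => hv i hi)
  obtain ⟨ρ, hρ1, hρ2⟩ := fiber_perm (Finset.range Q) (parentMap v)
    (fun c => π (parentMap v' c)) (by
      intro b
      have : ∀ c, (π (parentMap v' c) = b) ↔ parentMap v' c = π.symm b := by
        intro c
        rw [Equiv.eq_symm_apply]
      simp_rw [this]
      rw [parentMap_fiber v q Q _ hs, parentMap_fiber v' q Q _ hs']
      have h2 := hπ (π.symm b)
      rw [Equiv.apply_symm_apply] at h2
      by_cases hb : b < q
      · have h3 := h2.mp (Finset.mem_range.mpr hb)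
        rw [if_pos hb, if_pos (Finset.mem_range.mp h3), hv _ h3, Equiv.apply_symm_apply]
      · rw [if_neg hb, if_neg]
        intro h3
        exact hb (Finset.mem_range.mp (h2.mpr (Finset.mem_range.mpr h3))))
  have hsub : ∀ C, C ∈ (Finset.range Q).powerset ↔ ρ.finsetCongr C ∈ (Finset.range Q).powerset := by
    intro C
    simp only [Finset.mem_powerset, Equiv.finsetCongr_apply]
    constructor
    · intro h x hx
      obtain ⟨c, hc, rfl⟩ := Finset.mem_map.mp hx
      exact (hρ1 c).mpr (h hc)
    · intro h x hx
      exact (hρ1 x).mp (h (Finset.mem_map_of_mem _ hx))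
  refine Finset.sum_equiv ρ.finsetCongr hsub ?_
  intro C hC
  have hC' := (hsub C).mp hC
  rw [Finset.mem_powerset] at hC hC'
  rw [hf _ _ hC hC' (by simp [Equiv.finsetCongr_apply])]
  congr 1
  have himg : (ρ.finsetCongr C).image (parentMap v) = (C.image (parentMap v')).image π := by
    rw [Equiv.finsetCongr_apply, Finset.map_eq_image, Finset.image_image, Finset.image_image]
    refine Finset.image_congr ?_
    intro c hc
    exact hρ2 c (hC hc)
  rw [himg]
  have : ((C.image (parentMap v')).image π = B.image π) ↔ C.image (parentMap v') = B :=
    ⟨fun h => Finset.image_injective π.injective h, fun h => by rw [h]⟩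
  simp only [this]

/-- move subsets -/
theorem move_perm (q : ℕ) (B B' : Finset ℕ) (hB : B ⊆ Finset.range q) (hB' : B' ⊆ Finset.range q)
    (hc : B.card = B'.card) : ∃ π : Equiv.Perm ℕ,
      (∀ c, π c ∈ Finset.range q ↔ c ∈ Finset.range q) ∧ B.image π = B' := by
  classical
  have hcard : ∀ D : Finset ℕ, D ⊆ Finset.range q → ∀ b : Bool,
      ((Finset.range q).filter (fun c => decide (c ∈ D) = b)).card
        = if b then D.card else q - D.card := by
    intro D hD b
    cases b
    · have : (Finset.range q).filter (fun c => decide (c ∈ D) = false) = Finset.range q \ D := by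
        ext; simp
      rw [this, Finset.card_sdiff_of_subset hD]; simp
    · have : (Finset.range q).filter (fun c => decide (c ∈ D) = true) = D := by
        ext x; simpa using fun h => Finset.mem_range.mp (hD h)
      rw [this]; simp
  obtain ⟨π, h1, h2⟩ := fiber_perm (Finset.range q) (fun c => decide (c ∈ B'))
    (fun c => decide (c ∈ B)) (fun b => by rw [hcard B' hB', hcard B hB, hc])
  refine ⟨π, h1, ?_⟩
  apply Finset.eq_of_subset_of_card_le
  · intro x hx
    obtain ⟨c, hc, rfl⟩ := Finset.mem_image.mp hx
    have := h2 c (hB hc)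
    simpa [hc] using this
  · rw [Finset.card_image_of_injective _ π.injective, hc]

/-- perm of `Fin q` from a perm of ℕ preserving `range q`. -/
theorem fin_perm (q : ℕ) (π : Equiv.Perm ℕ)
    (hπ : ∀ c, π c ∈ Finset.range q ↔ c ∈ Finset.range q) :
    ∃ p : Equiv.Perm (Fin q), ∀ i, ((p i : Fin q) : ℕ) = π i := by
  refine ⟨⟨fun i => ⟨π i, Finset.mem_range.mp ((hπ _).mpr (Finset.mem_range.mpr i.2))⟩,
    fun i => ⟨π.symm i, Finset.mem_range.mp ((hπ _).mp (by simp))⟩, ?_, ?_⟩, ?_⟩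
  · intro i; simp
  · intro i; simp
  · intro i; rfl

theorem meas_parentMap (c : ℕ) : Measurable (fun v : ℕ → ℕ => parentMap v c) := by
  have hm : ∀ i, MeasurableSet {v : ℕ → ℕ | c < ∑ j ∈ Finset.range (i + 1), v j} := by
    intro i
    exact measurableSet_lt measurable_const (Finset.measurable_sum _ (fun j _ => measurable_pi_apply j))
  refine measurable_to_countable' ?_
  intro n
  have : (fun v : ℕ → ℕ => parentMap v c) ⁻¹' {n}
      = {v | (c < ∑ j ∈ Finset.range (n + 1), v j ∧
              ∀ l, l < n → ¬ c < ∑ j ∈ Finset.range (l + 1), v j)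
            ∨ (n = 0 ∧ ∀ l, ¬ c < ∑ j ∈ Finset.range (l + 1), v j)} := by
    ext v
    simp only [Set.mem_preimage, Set.mem_singleton_iff, Set.mem_ofPred_eq]
    constructor
    · intro h
      by_cases hne : {i : ℕ | c < ∑ j ∈ Finset.range (i + 1), v j}.Nonempty
      · left
        refine ⟨?_, ?_⟩
        · have := Nat.sInf_mem hne
          rwa [show sInf {i : ℕ | c < ∑ j ∈ Finset.range (i + 1), v j} = n from h] at this
        · intro l hl
          have : l < sInf {i : ℕ | c < ∑ j ∈ Finset.range (i + 1), v j} := by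
            change l < parentMap v c
            omega
          have h3 := Nat.notMem_of_lt_sInf this
          exact h3
      · right
        rw [Set.not_nonempty_iff_eq_empty] at hne
        refine ⟨?_, ?_⟩
        · rw [← h]; unfold parentMap; rw [hne]; simp
        · intro l hl
          have : l ∈ {i : ℕ | c < ∑ j ∈ Finset.range (i + 1), v j} := hl
          rw [hne] at this; exact this
    · rintro (⟨h1, h2⟩ | ⟨rfl, h2⟩)
      · apply le_antisymm
        · exact Nat.sInf_le h1
        · by_contra hlt
          push Not at hlt
          exact h2 _ hlt (Nat.sInf_mem (s := {i : ℕ | c < ∑ j ∈ Finset.range (i + 1), v j}) ⟨n, h1⟩)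
      · unfold parentMap
        have : {i : ℕ | c < ∑ j ∈ Finset.range (i + 1), v j} = ∅ := by
          ext l; simpa using h2 l
        rw [this]; simp
  rw [this]
  refine MeasurableSet.union ((hm n).inter ?_) ?_
  · change MeasurableSet {v : ℕ → ℕ | ∀ l, l < n → ¬ c < ∑ j ∈ Finset.range (l + 1), v j}
    simp only [Set.ofPred_forall]
    exact MeasurableSet.iInter fun l => MeasurableSet.iInter fun _ => (hm l).compl
  · refine MeasurableSet.inter (MeasurableSet.const _) ?_
    change MeasurableSet {v : ℕ → ℕ | ∀ l, ¬ c < ∑ j ∈ Finset.range (l + 1), v j}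
    simp only [Set.ofPred_forall]
    exact MeasurableSet.iInter fun l => (hm l).compl

theorem meas_image (C : Finset ℕ) (p : Finset ℕ → Prop) :
    MeasurableSet {v : ℕ → ℕ | p (C.image (parentMap v))} := by
  have h1 : Measurable (fun (v : ℕ → ℕ) (c : {x // x ∈ C}) => parentMap v c) :=
    measurable_pi_lambda _ (fun c => meas_parentMap c)
  have : {v : ℕ → ℕ | p (C.image (parentMap v))}
      = (fun (v : ℕ → ℕ) (c : {x // x ∈ C}) => parentMap v c) ⁻¹'
          {g | p (Finset.univ.image g)} := by
    ext v
    have : C.image (parentMap v) = Finset.univ.image (fun c : {x // x ∈ C} => parentMap v c) := by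
      ext x; simp
    simp only [Set.mem_preimage, Set.mem_ofPred_eq, this]
  rw [this]
  exact h1 (MeasurableSet.of_discrete)

/-- partition over the values of a finset-valued random variable -/
theorem measure_partition {Ω α : Type*} [MeasurableSpace Ω] (P : Measure Ω)
    (A : Ω → α) (hA : ∀ B, MeasurableSet {ω | A ω = B}) (F : Finset α) (E : Set Ω)
    (hF : ∀ᵐ ω ∂P, ω ∈ E → A ω ∈ F) :
    P E = ∑ B ∈ F, P ({ω | A ω = B} ∩ E) := by
  have h1 : ∀ B, P ({ω | A ω = B} ∩ E) = (P.restrict E) (A ⁻¹' {B}) := by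
    intro B
    have : A ⁻¹' {B} = {ω | A ω = B} := rfl
    rw [this, Measure.restrict_apply (hA B)]
  simp_rw [h1]
  have hm : MeasurableSet (A ⁻¹' (F : Set α)) := by
    have : A ⁻¹' (F : Set α) = ⋃ B ∈ F, {ω | A ω = B} := by ext; simp
    rw [this]
    exact Finset.measurableSet_biUnion _ (fun B _ => hA B)
  rw [sum_measure_preimage_singleton F (fun y _ => hA y), Measure.restrict_apply hm]
  apply measure_congr
  filter_upwards [hF] with ω h
  exact propext ⟨fun h2 => ⟨h h2, h2⟩, fun h2 => h2.2⟩

/-- symmetry of the weighted sums under exchangeability -/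
theorem exch_sym {Ω : Type*} [MeasurableSpace Ω] (P : Measure Ω)
    (v : Ω → ℕ → ℕ) (hv : Measurable v) (q Q : ℕ)
    (hs : ∀ᵐ ω ∂P, ∑ a ∈ Finset.range q, v ω a = Q)
    (hexch : ∀ π : Equiv.Perm (Fin q),
      Measure.map (fun ω => fun i : Fin q => v ω (π i)) P
        = Measure.map (fun ω => fun i : Fin q => v ω i) P)
    (f : Finset ℕ → ℝ≥0∞)
    (hf : ∀ C C', C ⊆ Finset.range Q → C' ⊆ Finset.range Q → C.card = C'.card → f C = f C')
    (B B' : Finset ℕ) (hB : B ⊆ Finset.range q) (hB' : B' ⊆ Finset.range q)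
    (hc : B.card = B'.card) :
    ∑ C ∈ (Finset.range Q).powerset, f C * P (v ⁻¹' {w | C.image (parentMap w) = B})
    = ∑ C ∈ (Finset.range Q).powerset, f C * P (v ⁻¹' {w | C.image (parentMap w) = B'}) := by
  classical
  have hint : ∀ D : Finset ℕ,
      ∑ C ∈ (Finset.range Q).powerset, f C * P (v ⁻¹' {w | C.image (parentMap w) = D})
      = ∫⁻ ω, ∑ C ∈ (Finset.range Q).powerset,
          f C * (if C.image (parentMap (v ω)) = D then 1 else 0) ∂P := by
    intro D
    have hms : ∀ C : Finset ℕ, MeasurableSet (v ⁻¹' {w | C.image (parentMap w) = D}) :=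
      fun C => hv (meas_image C (fun x => x = D))
    have hmi : ∀ C : Finset ℕ, Measurable
        (fun ω => (if C.image (parentMap (v ω)) = D then 1 else 0 : ℝ≥0∞)) :=
      fun C => Measurable.ite (hms C) measurable_const measurable_const
    rw [lintegral_finsetSum _ (fun C _ => (hmi C).const_mul _)]
    refine Finset.sum_congr rfl fun C _ => ?_
    rw [lintegral_const_mul _ (hmi C)]
    congr 1
    rw [← lintegral_indicator_one (hms C)]
    refine lintegral_congr fun ω => ?_
    simp [Set.indicator_apply]
  obtain ⟨π, hπ, hπB⟩ := move_perm q B B' hB hB' hc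
  obtain ⟨p, hp⟩ := fin_perm q π hπ
  let ext : (Fin q → ℕ) → ℕ → ℕ := fun w n => if h : n < q then w ⟨n, h⟩ else 0
  let Φ : (Fin q → ℕ) → ℝ≥0∞ := fun w => ∑ C ∈ (Finset.range Q).powerset,
          f C * (if C.image (parentMap (ext w)) = B then 1 else 0)
  have hΦ : Measurable Φ := Measurable.of_discrete
  rw [hint, hint]
  calc _ = ∫⁻ ω, Φ (fun i : Fin q => v ω i) ∂P := by
        refine lintegral_congr_ae ?_
        filter_upwards [hs] with ω hω
        have := pointwise_sym (v ω) (ext (fun i : Fin q => v ω i)) q Q hω (Equiv.refl ℕ)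
          (fun c => Iff.rfl) (by
            intro n hn
            simp [ext, Finset.mem_range.mp hn]) f hf B
        rw [show B.image (Equiv.refl ℕ) = B by simp] at this
        exact this.symm
    _ = ∫⁻ w, Φ w ∂(Measure.map (fun ω => fun i : Fin q => v ω i) P) := by
        rw [lintegral_map hΦ]
        exact measurable_pi_lambda _ (fun i => (measurable_pi_apply _).comp hv)
    _ = ∫⁻ w, Φ w ∂(Measure.map (fun ω => fun i : Fin q => v ω (p i)) P) := by
        rw [hexch p]
    _ = ∫⁻ ω, Φ (fun i : Fin q => v ω (p i)) ∂P := by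
        rw [lintegral_map hΦ]
        exact measurable_pi_lambda _ (fun i => (measurable_pi_apply _).comp hv)
    _ = _ := by
        refine lintegral_congr_ae ?_
        filter_upwards [hs] with ω hω
        have := pointwise_sym (v ω) (ext (fun i : Fin q => v ω (p i))) q Q hω π hπ (by
            intro n hn
            simp [ext, Finset.mem_range.mp hn, hp]) f hf B
        rw [hπB] at this
        exact this

/-- induction step -/
theorem step_lemma {Ω : Type*} [MeasurableSpace Ω] (P : Measure Ω)
    (v : Ω → ℕ → ℕ) (hv : Measurable v) (q Q : ℕ)
    (hs : ∀ᵐ ω ∂P, ∑ a ∈ Finset.range q, v ω a = Q)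
    (hexch : ∀ π : Equiv.Perm (Fin q),
      Measure.map (fun ω => fun i : Fin q => v ω (π i)) P
        = Measure.map (fun ω => fun i : Fin q => v ω i) P)
    (A : Ω → Finset ℕ) (hA : ∀ B, MeasurableSet {ω | A ω = B})
    (hsub : ∀ᵐ ω ∂P, A ω ⊆ Finset.range Q)
    (H U : Set Ω) (p : ℝ≥0∞)
    (hU : ∀ B B', B ⊆ Finset.range Q → B' ⊆ Finset.range Q → B.card = B'.card →
      ∀ V, MeasurableSet V →
      P ({ω | A ω = B} ∩ H ∩ (U ∩ v ⁻¹' V)) = P ({ω | A ω = B'} ∩ H) * (p * P (v ⁻¹' V)))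
    (hsym : ∀ B B', B ⊆ Finset.range Q → B' ⊆ Finset.range Q → B.card = B'.card →
      P ({ω | A ω = B} ∩ H) = P ({ω | A ω = B'} ∩ H))
    (hind : ∀ B, B ⊆ Finset.range Q → ∀ V, MeasurableSet V →
      P ({ω | A ω = B} ∩ H ∩ v ⁻¹' V) = P ({ω | A ω = B} ∩ H) * P (v ⁻¹' V))
    (B B' : Finset ℕ) (hB : B ⊆ Finset.range q) (hB' : B' ⊆ Finset.range q)
    (hc : B.card = B'.card) :
    P ({ω | (A ω).image (parentMap (v ω)) = B} ∩ H ∩ U)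
      = P ({ω | (A ω).image (parentMap (v ω)) = B'} ∩ H) * p := by
  have hF : ∀ E : Set Ω, ∀ᵐ ω ∂P, ω ∈ E → A ω ∈ (Finset.range Q).powerset := by
    intro E
    filter_upwards [hsub] with ω h _
    exact Finset.mem_powerset.mpr h
  rw [measure_partition P A hA _ _ (hF _),
    measure_partition P A hA _ ({ω | (A ω).image (parentMap (v ω)) = B'} ∩ H) (hF _)]
  have e1 : ∀ C ∈ (Finset.range Q).powerset,
      P ({ω | A ω = C} ∩ ({ω | (A ω).image (parentMap (v ω)) = B} ∩ H ∩ U))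
      = P ({ω | A ω = C} ∩ H) * P (v ⁻¹' {w | C.image (parentMap w) = B}) * p := by
    intro C hC
    have hC := Finset.mem_powerset.mp hC
    have : {ω | A ω = C} ∩ ({ω | (A ω).image (parentMap (v ω)) = B} ∩ H ∩ U)
      = {ω | A ω = C} ∩ H ∩ (U ∩ v ⁻¹' {w | C.image (parentMap w) = B}) := by
      ext ω
      simp only [Set.mem_inter_iff, Set.mem_ofPred_eq, Set.mem_preimage]
      constructor
      · rintro ⟨rfl, ⟨h1, h2⟩, h3⟩; exact ⟨⟨rfl, h2⟩, h3, h1⟩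
      · rintro ⟨⟨rfl, h2⟩, h3, h1⟩; exact ⟨rfl, ⟨h1, h2⟩, h3⟩
    rw [this, hU C C hC hC rfl _ (meas_image C (fun x => x = B))]
    ring
  have e2 : ∀ C ∈ (Finset.range Q).powerset,
      P ({ω | A ω = C} ∩ ({ω | (A ω).image (parentMap (v ω)) = B'} ∩ H))
      = P ({ω | A ω = C} ∩ H) * P (v ⁻¹' {w | C.image (parentMap w) = B'}) := by
    intro C hC
    have hC := Finset.mem_powerset.mp hC
    have : {ω | A ω = C} ∩ ({ω | (A ω).image (parentMap (v ω)) = B'} ∩ H)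
      = {ω | A ω = C} ∩ H ∩ v ⁻¹' {w | C.image (parentMap w) = B'} := by
      ext ω
      simp only [Set.mem_inter_iff, Set.mem_ofPred_eq, Set.mem_preimage]
      constructor
      · rintro ⟨rfl, h1, h2⟩; exact ⟨⟨rfl, h2⟩, h1⟩
      · rintro ⟨⟨rfl, h2⟩, h1⟩; exact ⟨rfl, h1, h2⟩
    rw [this, hind C hC _ (meas_image C (fun x => x = B'))]
  rw [Finset.sum_congr rfl e1, Finset.sum_congr rfl e2, ← Finset.sum_mul]
  congr 1
  exact exch_sym P v hv q Q hs hexch (fun C => P ({ω | A ω = C} ∩ H)) hsym B B' hB hB' hc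

theorem permVal_lt {Q : ℕ} (hQ : 0 < Q) (e : Equiv.Perm (Fin Q)) (i : ℕ) : permVal e i < Q := by
  unfold permVal
  split_ifs with h
  · exact (e ⟨i, h⟩).2
  · exact hQ

theorem permVal_image_card {Q k : ℕ} (hk : k ≤ Q) (e : Equiv.Perm (Fin Q)) :
    ((Finset.range k).image (permVal e)).card = k := by
  rw [Finset.card_image_of_injOn, Finset.card_range]
  intro a ha b hb hab
  have ha : a < Q := lt_of_lt_of_le (by simpa using ha) hk
  have hb : b < Q := lt_of_lt_of_le (by simpa using hb) hk
  simp only [permVal, ha, hb, dif_pos] at hab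
  have := e.injective (Fin.ext hab)
  simpa using this

/-- base case -/
theorem base_lemma {Ω : Type*} [MeasurableSpace Ω] (P : Measure Ω)
    (Q k : ℕ) (hk : k ≤ Q) (σ : Ω → Equiv.Perm (Fin Q))
    (hσ : ∀ e, MeasurableSet {ω | σ ω = e})
    (hunif : ∀ e, P {ω | σ ω = e} = 1 / (Nat.factorial Q : ℝ≥0∞))
    (U : Set Ω) (p : ℝ≥0∞)
    (hU : ∀ e, P ({ω | σ ω = e} ∩ U) = P {ω | σ ω = e} * p)
    (B B' : Finset ℕ) (hB : B ⊆ Finset.range Q) (hB' : B' ⊆ Finset.range Q)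
    (hc : B.card = B'.card) :
    P ({ω | (Finset.range k).image (permVal (σ ω)) = B} ∩ U)
      = P {ω | (Finset.range k).image (permVal (σ ω)) = B'} * p := by
  classical
  rw [measure_partition P σ hσ Finset.univ _ (by simp),
    measure_partition P σ hσ Finset.univ {ω | (Finset.range k).image (permVal (σ ω)) = B'} (by simp)]
  rw [Finset.sum_mul]
  obtain ⟨π, hπ, hπB⟩ := move_perm Q B B' hB hB' hc
  obtain ⟨r, hr⟩ := fin_perm Q π hπ
  refine Finset.sum_equiv (Equiv.mulLeft r) (by simp) ?_
  intro e _
  have him : (Finset.range k).image (permVal (r * e))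
      = ((Finset.range k).image (permVal e)).image π := by
    rw [Finset.image_image]
    refine Finset.image_congr ?_
    intro i hi
    have hi : i < Q := lt_of_lt_of_le (by simpa using hi) hk
    simp [permVal, hi, hr]
  by_cases h : (Finset.range k).image (permVal e) = B
  · have h1 : {ω | σ ω = e} ∩ ({ω | (Finset.range k).image (permVal (σ ω)) = B} ∩ U)
        = {ω | σ ω = e} ∩ U := by
      ext ω
      simp only [Set.mem_inter_iff, Set.mem_ofPred_eq]
      constructor
      · rintro ⟨h1, _, h3⟩; exact ⟨h1, h3⟩
      · rintro ⟨h1, h3⟩; exact ⟨h1, h1 ▸ h, h3⟩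
    have h2 : {ω | σ ω = (Equiv.mulLeft r) e} ∩
        {ω | (Finset.range k).image (permVal (σ ω)) = B'}
        = {ω | σ ω = r * e} := by
      ext ω
      simp only [Set.mem_inter_iff, Set.mem_ofPred_eq, Equiv.coe_mulLeft]
      constructor
      · rintro ⟨h1, _⟩; exact h1
      · intro h1
        refine ⟨h1, ?_⟩
        rw [h1, him, h, hπB]
    rw [h1, h2, hU, hunif, hunif]
  · have h1 : {ω | σ ω = e} ∩ ({ω | (Finset.range k).image (permVal (σ ω)) = B} ∩ U) = ∅ := by
      ext ω
      simp only [Set.mem_inter_iff, Set.mem_ofPred_eq, Set.mem_empty_iff_false, iff_false]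
      rintro ⟨h1, h2, _⟩
      exact h (h1 ▸ h2)
    have h2 : {ω | σ ω = (Equiv.mulLeft r) e} ∩
        {ω | (Finset.range k).image (permVal (σ ω)) = B'} = ∅ := by
      ext ω
      simp only [Set.mem_inter_iff, Set.mem_ofPred_eq, Equiv.coe_mulLeft, Set.mem_empty_iff_false,
        iff_false]
      rintro ⟨h1, h2⟩
      rw [h1, him, ← hπB] at h2
      exact h (Finset.image_injective π.injective h2)
    rw [h1, h2]; simp

/-- final averaging lemma -/
theorem final_lemma {Ω : Type*} [MeasurableSpace Ω] (P : Measure Ω) [IsFiniteMeasure P]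
    (v : Ω → ℕ → ℕ) (hv : Measurable v) (Q n n' : ℕ)
    (A : Ω → Finset ℕ) (hA : ∀ B, MeasurableSet {ω | A ω = B})
    (hsub : ∀ᵐ ω ∂P, A ω ⊆ Finset.range Q)
    (H : Set Ω) (hH : ∀ ω ∈ H, (A ω).card = n) (hpos : P H ≠ 0)
    (hsym : ∀ B B', B ⊆ Finset.range Q → B' ⊆ Finset.range Q → B.card = B'.card →
      P ({ω | A ω = B} ∩ H) = P ({ω | A ω = B'} ∩ H))
    (hind : ∀ B, B ⊆ Finset.range Q → ∀ V, MeasurableSet V →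
      P ({ω | A ω = B} ∩ H ∩ v ⁻¹' V) = P ({ω | A ω = B} ∩ H) * P (v ⁻¹' V)) :
    n ≤ Q ∧ P ({ω | ((A ω).image (parentMap (v ω))).card = n'} ∩ H) / P H
      = (∑ B ∈ (Finset.range Q).powersetCard n,
          (Measure.map v P) {w | (B.image (parentMap w)).card = n'}) / (Q.choose n : ℝ≥0∞) := by
  have hF : ∀ E : Set Ω, E ⊆ H → ∀ᵐ ω ∂P, ω ∈ E → A ω ∈ (Finset.range Q).powersetCard n := by
    intro E hE
    filter_upwards [hsub] with ω h hω
    exact Finset.mem_powersetCard.mpr ⟨h, hH ω (hE hω)⟩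
  have hPH := measure_partition P A hA _ H (hF H subset_rfl)
  have hn : n ≤ Q := by
    by_contra hlt
    push Not at hlt
    rw [Finset.powersetCard_eq_empty.mpr (by simpa using hlt)] at hPH
    exact hpos (by simpa using hPH)
  have hC : ∀ B ∈ (Finset.range Q).powersetCard n,
      P ({ω | A ω = B} ∩ H) * (Q.choose n : ℝ≥0∞) = P H := by
    intro B hB
    have hB := Finset.mem_powersetCard.mp hB
    rw [hPH, Finset.sum_congr rfl (fun B' hB' => by
      have hB' := Finset.mem_powersetCard.mp hB'
      exact hsym B' B hB'.1 hB.1 (hB'.2.trans hB.2.symm))]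
    rw [Finset.sum_const, Finset.card_powersetCard, Finset.card_range, nsmul_eq_mul, mul_comm]
  refine ⟨hn, ?_⟩
  have hc0 : (Q.choose n : ℝ≥0∞) ≠ 0 := by
    exact_mod_cast (Nat.choose_pos hn).ne'
  have hct : (Q.choose n : ℝ≥0∞) ≠ ⊤ := ENNReal.natCast_ne_top _
  have key : P ({ω | ((A ω).image (parentMap (v ω))).card = n'} ∩ H) * (Q.choose n : ℝ≥0∞)
      = (∑ B ∈ (Finset.range Q).powersetCard n,
          (Measure.map v P) {w | (B.image (parentMap w)).card = n'}) * P H := by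
    rw [measure_partition P A hA _ ({ω | ((A ω).image (parentMap (v ω))).card = n'} ∩ H)
      (hF _ Set.inter_subset_right), Finset.sum_mul, Finset.sum_mul]
    refine Finset.sum_congr rfl fun B hB => ?_
    have : {ω | A ω = B} ∩ ({ω | ((A ω).image (parentMap (v ω))).card = n'} ∩ H)
      = {ω | A ω = B} ∩ H ∩ v ⁻¹' {w | (B.image (parentMap w)).card = n'} := by
      ext ω
      simp only [Set.mem_inter_iff, Set.mem_ofPred_eq, Set.mem_preimage]
      constructor
      · rintro ⟨rfl, h1, h2⟩; exact ⟨⟨rfl, h2⟩, h1⟩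
      · rintro ⟨⟨rfl, h2⟩, h1⟩; exact ⟨rfl, h1, h2⟩
    have hms := meas_image B (fun x => x.card = n')
    rw [this, hind B (Finset.mem_powersetCard.mp hB).1 _ hms, Measure.map_apply hv hms,
      ← hC B hB]
    ring
  rw [ENNReal.eq_div_iff hc0 hct, ← mul_div_assoc, mul_comm, key]
  exact ENNReal.mul_div_cancel_right hpos (measure_ne_top _ _)

theorem ancTo_succ (fam : ℕ → ℕ → ℕ) (i T c : ℕ) (h : i < T) :
    ancTo fam i T c = parentMap (fam i) (ancTo fam (i + 1) T c) := by
  induction T generalizing c with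
  | zero => omega
  | succ T ih =>
    by_cases hi : i < T
    · have h1 : i ≤ T := hi.le
      have h2 : i + 1 ≤ T := hi
      simp only [ancTo, h1, h2, if_true]
      exact ih _ hi
    · have : i = T := by omega
      subst this
      have h3 : ∀ c, ancTo fam i i c = c := by
        intro c
        cases i with
        | zero => rfl
        | succ n => simp [ancTo]
      simp [ancTo, h3]

theorem ancTo_self (fam : ℕ → ℕ → ℕ) (T c : ℕ) : ancTo fam T T c = c := by
  cases T with
  | zero => rfl
  | succ n => simp [ancTo]

/-- the set of ancestors at height `j` -/
noncomputable def ancSet (q : ℕ → ℕ) (T k : ℕ) (fam : ℕ → ℕ → ℕ)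
    (e : Equiv.Perm (Fin (q T))) (j : ℕ) : Finset ℕ :=
  (Finset.range k).image (fun i => ancTo fam j T (permVal e i))

theorem ancSet_succ (q : ℕ → ℕ) (T k : ℕ) (fam : ℕ → ℕ → ℕ)
    (e : Equiv.Perm (Fin (q T))) (j : ℕ) (h : j < T) :
    ancSet q T k fam e j = (ancSet q T k fam e (j + 1)).image (parentMap (fam j)) := by
  unfold ancSet
  rw [Finset.image_image]
  refine Finset.image_congr ?_
  intro i _
  exact ancTo_succ fam j T _ h

theorem ancSet_self (q : ℕ → ℕ) (T k : ℕ) (fam : ℕ → ℕ → ℕ)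
    (e : Equiv.Perm (Fin (q T))) :
    ancSet q T k fam e T = (Finset.range k).image (permVal e) := by
  unfold ancSet
  simp only [ancTo_self]

theorem meas_perm_image {Ω : Type*} [MeasurableSpace Ω] {Q : ℕ} (σ : Ω → Equiv.Perm (Fin Q))
    (hσ : ∀ e, MeasurableSet {ω | σ ω = e}) (k : ℕ) (B : Finset ℕ) :
    MeasurableSet {ω | (Finset.range k).image (permVal (σ ω)) = B} := by
  have : {ω | (Finset.range k).image (permVal (σ ω)) = B}
      = ⋃ e ∈ {e : Equiv.Perm (Fin Q) | (Finset.range k).image (permVal e) = B},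
          {ω | σ ω = e} := by
    ext ω; simp
  rw [this]
  exact MeasurableSet.biUnion (Set.to_countable _) (fun e _ => hσ e)

theorem core_ind
    {Ω : Type*} [MeasurableSpace Ω] (P : Measure Ω) [IsProbabilityMeasure P]
    (T : ℕ) (q : ℕ → ℕ) (hq : ∀ s ≤ T, 0 < q s)
    (ν : ℕ → Ω → ℕ → ℕ) (hνmeas : ∀ s, Measurable (ν s))
    (hsum : ∀ s < T, ∀ᵐ ω ∂P, ∑ i ∈ Finset.range (q s), ν s ω i = q (s + 1))
    (hexch : ∀ s < T, ∀ π : Equiv.Perm (Fin (q s)),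
      Measure.map (fun ω => fun i : Fin (q s) => ν s ω (π i)) P
        = Measure.map (fun ω => fun i : Fin (q s) => ν s ω i) P)
    (σ : Ω → Equiv.Perm (Fin (q T)))
    (hσmeas : ∀ e, MeasurableSet {ω | σ ω = e})
    (hσunif : ∀ e : Equiv.Perm (Fin (q T)),
      P {ω | σ ω = e} = 1 / (Nat.factorial (q T) : ℝ≥0∞))
    (hindep : ∀ (e : Equiv.Perm (Fin (q T))) (S : ℕ → Set (ℕ → ℕ)),
      (∀ s, MeasurableSet (S s)) →
      P ({ω | σ ω = e} ∩ ⋂ s ∈ Finset.range T, (ν s) ⁻¹' (S s))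
        = P {ω | σ ω = e} * ∏ s ∈ Finset.range T, P ((ν s) ⁻¹' (S s)))
    (k : ℕ) (hkq : k ≤ q T) (m : ℕ → ℕ) (d i : ℕ) (hd : i + d = T) :
    (∀ B, MeasurableSet {ω | ancSet q T k (fun s => ν s ω) (σ ω) i = B}) ∧
    (∀ᵐ ω ∂P, ancSet q T k (fun s => ν s ω) (σ ω) i ⊆ Finset.range (q i)) ∧
    ∀ (L : ℕ → Prop) (S : ℕ → Set (ℕ → ℕ)), (∀ s, MeasurableSet (S s)) →
      ∀ B B', B ⊆ Finset.range (q i) → B' ⊆ Finset.range (q i) → B.card = B'.card →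
      P ({ω | ancSet q T k (fun s => ν s ω) (σ ω) i = B} ∩
          {ω | ∀ l, L l → i ≤ l → l ≤ T → coalX q T k (fun s => ν s ω) (σ ω) l = m l} ∩
          ⋂ s ∈ Finset.range i, (ν s) ⁻¹' (S s))
      = P ({ω | ancSet q T k (fun s => ν s ω) (σ ω) i = B'} ∩
          {ω | ∀ l, L l → i ≤ l → l ≤ T → coalX q T k (fun s => ν s ω) (σ ω) l = m l})
        * ∏ s ∈ Finset.range i, P ((ν s) ⁻¹' (S s)) := by
  induction d generalizing i with
  | zero =>
    have : i = T := by omega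
    subst this
    simp only [ancSet_self]
    refine ⟨meas_perm_image σ hσmeas k, ?_, ?_⟩
    · refine Filter.Eventually.of_forall fun ω x hx => ?_
      obtain ⟨a, _, rfl⟩ := Finset.mem_image.mp hx
      exact Finset.mem_range.mpr (permVal_lt (hq i le_rfl) _ _)
    · intro L S hS B B' hB hB' hc
      have hH : {ω | ∀ l, L l → i ≤ l → l ≤ i → coalX q i k (fun s => ν s ω) (σ ω) l = m l}
          = {ω : Ω | L i → k = m i} := by
        ext ω
        have hk : coalX q i k (fun s => ν s ω) (σ ω) i = k := by
          change (ancSet q i k (fun s => ν s ω) (σ ω) i).card = k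
          rw [ancSet_self, permVal_image_card hkq]
        simp only [Set.mem_ofPred_eq]
        constructor
        · intro h hL
          rw [← h i hL le_rfl le_rfl, hk]
        · intro h l hl h1 h2
          have : l = i := by omega
          subst this
          rw [hk]; exact h hl
      rw [hH]
      by_cases hL : L i → k = m i
      · have : {ω : Ω | L i → k = m i} = Set.univ := by ext; simpa using hL
        rw [this, Set.inter_univ, Set.inter_univ]
        exact base_lemma P (q i) k hkq σ hσmeas hσunif _ _ (fun e => hindep e S hS) B B' hB hB' hc
      · have : {ω : Ω | L i → k = m i} = ∅ := by ext; simpa using hL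
        rw [this]; simp
  | succ d ih =>
    have hiT : i < T := by omega
    obtain ⟨hA, hsub, hL⟩ := ih (i + 1) (by omega)
    have hsucc : ∀ ω, ancSet q T k (fun s => ν s ω) (σ ω) i
        = (ancSet q T k (fun s => ν s ω) (σ ω) (i + 1)).image (parentMap (ν i ω)) :=
      fun ω => ancSet_succ q T k _ _ i hiT
    refine ⟨?_, ?_, ?_⟩
    · intro B
      simp only [hsucc]
      have : {ω | (ancSet q T k (fun s => ν s ω) (σ ω) (i + 1)).image (parentMap (ν i ω)) = B}
          = ⋃ C : Finset ℕ, {ω | ancSet q T k (fun s => ν s ω) (σ ω) (i + 1) = C} ∩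
              (ν i) ⁻¹' {w | C.image (parentMap w) = B} := by
        ext ω; simp
      rw [this]
      exact MeasurableSet.iUnion fun C =>
        (hA C).inter (hνmeas i (meas_image C (fun x => x = B)))
    · filter_upwards [hsub, hsum i hiT] with ω h1 h2
      rw [hsucc]
      intro x hx
      obtain ⟨c, hc, rfl⟩ := Finset.mem_image.mp hx
      exact Finset.mem_range.mpr (parentMap_lt _ _ _ _ h2 (Finset.mem_range.mp (h1 hc)))
    · intro L S hS B B' hB hB' hc
      have hL' := hL L
      generalize hHdef : {ω | ∀ l, L l → i + 1 ≤ l → l ≤ T →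
        coalX q T k (fun s => ν s ω) (σ ω) l = m l} = H at hL'
      have hH : ∀ D : Finset ℕ, {ω | ancSet q T k (fun s => ν s ω) (σ ω) i = D} ∩
          {ω | ∀ l, L l → i ≤ l → l ≤ T → coalX q T k (fun s => ν s ω) (σ ω) l = m l}
          = ({ω | ancSet q T k (fun s => ν s ω) (σ ω) i = D} ∩ H) ∩
            {ω : Ω | L i → D.card = m i} := by
        intro D
        rw [← hHdef]
        ext ω
        simp only [Set.mem_inter_iff, Set.mem_ofPred_eq]
        constructor
        · rintro ⟨rfl, h⟩
          exact ⟨⟨rfl, fun l h1 h2 h3 => h l h1 (by omega) h3⟩, fun h1 => h i h1 le_rfl hiT.le⟩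
        · rintro ⟨⟨rfl, h⟩, h'⟩
          refine ⟨rfl, fun l h1 h2 h3 => ?_⟩
          rcases Nat.eq_or_lt_of_le h2 with h4 | h4
          · subst h4; exact h' h1
          · exact h l h1 h4 h3
      rw [hH, hH, hc]
      by_cases hLi : L i → B'.card = m i
      · have : {ω : Ω | L i → B'.card = m i} = Set.univ := by ext; simpa using hLi
        rw [this, Set.inter_univ, Set.inter_univ]
        simp only [hsucc]
        -- general form of the induction hypothesis
        have gen : ∀ (S : ℕ → Set (ℕ → ℕ)), (∀ s, MeasurableSet (S s)) →
            ∀ B B', B ⊆ Finset.range (q (i+1)) → B' ⊆ Finset.range (q (i+1)) → B.card = B'.card →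
            ∀ V, MeasurableSet V →
            P ({ω | ancSet q T k (fun s => ν s ω) (σ ω) (i+1) = B} ∩ H ∩
                ((⋂ s ∈ Finset.range i, (ν s) ⁻¹' (S s)) ∩ (ν i) ⁻¹' V))
            = P ({ω | ancSet q T k (fun s => ν s ω) (σ ω) (i+1) = B'} ∩ H)
              * ((∏ s ∈ Finset.range i, P ((ν s) ⁻¹' (S s))) * P ((ν i) ⁻¹' V)) := by
          intro S hS B B' hB hB' hc V hV
          have h := hL' (Function.update S i V) (by
            intro s
            by_cases hs : s = i
            · subst hs; simpa using hV
            · simpa [hs] using hS s) B B' hB hB' hc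
          have hne : ∀ s ∈ Finset.range i, Function.update S i V s = S s := by
            intro s hs
            have : s ≠ i := (Finset.mem_range.mp hs).ne
            simp [this]
          rw [Finset.prod_range_succ, Finset.prod_congr rfl (fun s hs => by rw [hne s hs])] at h
          have hset : (⋂ s ∈ Finset.range (i+1), (ν s) ⁻¹' (Function.update S i V s))
              = (⋂ s ∈ Finset.range i, (ν s) ⁻¹' (S s)) ∩ (ν i) ⁻¹' V := by
            rw [Finset.range_add_one, Finset.set_biInter_insert, Set.inter_comm]
            congr 1
            · refine Set.iInter₂_congr fun s hs => ?_
              rw [hne s hs]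
            · simp
          rw [hset] at h
          simpa using h
        have gen0 := gen (fun _ => Set.univ) (fun _ => MeasurableSet.univ)
        simp only [Set.preimage_univ, Set.iInter_univ, Set.univ_inter, measure_univ,
          Finset.prod_const_one, one_mul] at gen0
        refine step_lemma P (ν i) (hνmeas i) (q i) (q (i+1)) (hsum i hiT) (hexch i hiT) _ hA hsub
          H _ _ (gen S hS) ?_ ?_ B B' hB hB' hc
        · intro B B' hB hB' hc
          have := gen0 B B' hB hB' hc Set.univ MeasurableSet.univ
          simpa using this
        · intro B hB V hV
          exact gen0 B B hB hB rfl V hV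
      · have : {ω : Ω | L i → B'.card = m i} = ∅ := by ext; simpa using hLi
        rw [this]; simp

theorem core
    {Ω : Type*} [MeasurableSpace Ω] (P : Measure Ω) [IsProbabilityMeasure P]
    (T : ℕ) (q : ℕ → ℕ) (hq : ∀ s ≤ T, 0 < q s)
    (ν : ℕ → Ω → ℕ → ℕ) (hνmeas : ∀ s, Measurable (ν s))
    (hsum : ∀ s < T, ∀ᵐ ω ∂P, ∑ i ∈ Finset.range (q s), ν s ω i = q (s + 1))
    (hexch : ∀ s < T, ∀ π : Equiv.Perm (Fin (q s)),
      Measure.map (fun ω => fun i : Fin (q s) => ν s ω (π i)) P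
        = Measure.map (fun ω => fun i : Fin (q s) => ν s ω i) P)
    (σ : Ω → Equiv.Perm (Fin (q T)))
    (hσmeas : ∀ e, MeasurableSet {ω | σ ω = e})
    (hσunif : ∀ e : Equiv.Perm (Fin (q T)),
      P {ω | σ ω = e} = 1 / (Nat.factorial (q T) : ℝ≥0∞))
    (hindep : ∀ (e : Equiv.Perm (Fin (q T))) (S : ℕ → Set (ℕ → ℕ)),
      (∀ s, MeasurableSet (S s)) →
      P ({ω | σ ω = e} ∩ ⋂ s ∈ Finset.range T, (ν s) ⁻¹' (S s))
        = P {ω | σ ω = e} * ∏ s ∈ Finset.range T, P ((ν s) ⁻¹' (S s)))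
    (k : ℕ) (hkq : k ≤ q T) (m : ℕ → ℕ) (j : ℕ) (hj1 : 1 ≤ j) (hjT : j ≤ T) :
    (∀ B, MeasurableSet {ω | ancSet q T k (fun s => ν s ω) (σ ω) j = B}) ∧
    (∀ᵐ ω ∂P, ancSet q T k (fun s => ν s ω) (σ ω) j ⊆ Finset.range (q j)) ∧
    ∀ (L : ℕ → Prop),
      (∀ B B', B ⊆ Finset.range (q j) → B' ⊆ Finset.range (q j) → B.card = B'.card →
      P ({ω | ancSet q T k (fun s => ν s ω) (σ ω) j = B} ∩
          {ω | ∀ l, L l → j ≤ l → l ≤ T → coalX q T k (fun s => ν s ω) (σ ω) l = m l})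
      = P ({ω | ancSet q T k (fun s => ν s ω) (σ ω) j = B'} ∩
          {ω | ∀ l, L l → j ≤ l → l ≤ T → coalX q T k (fun s => ν s ω) (σ ω) l = m l})) ∧
      (∀ B, B ⊆ Finset.range (q j) → ∀ V, MeasurableSet V →
      P ({ω | ancSet q T k (fun s => ν s ω) (σ ω) j = B} ∩
          {ω | ∀ l, L l → j ≤ l → l ≤ T → coalX q T k (fun s => ν s ω) (σ ω) l = m l} ∩
          (ν (j - 1)) ⁻¹' V)
      = P ({ω | ancSet q T k (fun s => ν s ω) (σ ω) j = B} ∩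
          {ω | ∀ l, L l → j ≤ l → l ≤ T → coalX q T k (fun s => ν s ω) (σ ω) l = m l}) *
          P ((ν (j - 1)) ⁻¹' V)) := by
  obtain ⟨hA, hsub, hL⟩ := core_ind P T q hq ν hνmeas hsum hexch σ hσmeas hσunif hindep k hkq m
    (T - j) j (by omega)
  refine ⟨hA, hsub, fun L => ⟨?_, ?_⟩⟩
  · intro B B' hB hB' hc
    have := hL L (fun _ => Set.univ) (fun _ => MeasurableSet.univ) B B' hB hB' hc
    simpa using this
  · intro B hB V hV
    have h := hL L (fun s => if s = j - 1 then V else Set.univ) (by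
      intro s
      split_ifs
      · exact hV
      · exact MeasurableSet.univ) B B hB hB rfl
    have hset : (⋂ s ∈ Finset.range j, (ν s) ⁻¹' (if s = j - 1 then V else Set.univ))
        = (ν (j - 1)) ⁻¹' V := by
      ext ω
      simp only [Set.mem_iInter, Finset.mem_range, Set.mem_preimage]
      constructor
      · intro h
        simpa using h (j - 1) (by omega)
      · intro h s hs
        split_ifs with h1
        · subst h1; exact h
        · trivial
    have hprod : ∏ s ∈ Finset.range j, P ((ν s) ⁻¹' (if s = j - 1 then V else Set.univ))
        = P ((ν (j - 1)) ⁻¹' V) := by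
      rw [Finset.prod_eq_single (j - 1)]
      · simp
      · intro s _ hs
        simp [hs]
      · intro h1
        exact absurd (Finset.mem_range.mpr (by omega)) h1
    rw [hset, hprod] at h
    exact h

/-- The time-reversed coalescent process `(X_{T-j})` is a Markov chain
whose transitions are given by a one-step parent-collision experiment: conditionally on
`{X_i = m_i, j ≤ i ≤ T}` (of positive probability), the law of `X_{j-1}` depends only on
`X_j = m_j`, and `P(X_{j-1} = m_{j-1} | X_j = m_j)` equals the probability that `m_j`
uniformly chosen distinct individuals of `{0,…,q j − 1}` have exactly `m_{j-1}` distinct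
parents under an independent offspring vector `ν'` distributed as `ν^{j-1}`. -/
theorem reversed_coalescent_is_markov
    {Ω : Type*} [MeasurableSpace Ω] (P : Measure Ω) [IsProbabilityMeasure P]
    (T : ℕ) (hT : 1 ≤ T) (q : ℕ → ℕ) (hq : ∀ s ≤ T, 0 < q s)
    (ν : ℕ → Ω → ℕ → ℕ) (hνmeas : ∀ s, Measurable (ν s))
    (hsum : ∀ s < T, ∀ᵐ ω ∂P, ∑ i ∈ Finset.range (q s), ν s ω i = q (s + 1))
    (hexch : ∀ s < T, ∀ π : Equiv.Perm (Fin (q s)),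
      Measure.map (fun ω => fun i : Fin (q s) => ν s ω (π i)) P
        = Measure.map (fun ω => fun i : Fin (q s) => ν s ω i) P)
    (σ : Ω → Equiv.Perm (Fin (q T)))
    (hσmeas : ∀ e, MeasurableSet {ω | σ ω = e})
    (hσunif : ∀ e : Equiv.Perm (Fin (q T)),
      P {ω | σ ω = e} = 1 / (Nat.factorial (q T) : ℝ≥0∞))
    -- mutual independence of `σ, ν^0, …, ν^{T-1}`
    (hindep : ∀ (e : Equiv.Perm (Fin (q T))) (S : ℕ → Set (ℕ → ℕ)),
      (∀ s, MeasurableSet (S s)) →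
      P ({ω | σ ω = e} ∩ ⋂ s ∈ Finset.range T, (ν s) ⁻¹' (S s))
        = P {ω | σ ω = e} * ∏ s ∈ Finset.range T, P ((ν s) ⁻¹' (S s)))
    (k : ℕ) (hk : 1 ≤ k) (hkq : k ≤ q T)
    (j : ℕ) (hj1 : 1 ≤ j) (hjT : j ≤ T)
    (m : ℕ → ℕ) (hm : ∀ i, j - 1 ≤ i → i ≤ T → 0 < m i)
    (hpos : 0 < P {ω | ∀ i, j ≤ i → i ≤ T →
      coalX q T k (fun s => ν s ω) (σ ω) i = m i}) :
    (P ({ω | coalX q T k (fun s => ν s ω) (σ ω) (j - 1) = m (j - 1)}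
          ∩ {ω | ∀ i, j ≤ i → i ≤ T →
              coalX q T k (fun s => ν s ω) (σ ω) i = m i})
        / P {ω | ∀ i, j ≤ i → i ≤ T →
              coalX q T k (fun s => ν s ω) (σ ω) i = m i}
      = P ({ω | coalX q T k (fun s => ν s ω) (σ ω) (j - 1) = m (j - 1)}
            ∩ {ω | coalX q T k (fun s => ν s ω) (σ ω) j = m j})
          / P {ω | coalX q T k (fun s => ν s ω) (σ ω) j = m j})
    ∧ ∀ (Ω' : Type) (_ : MeasurableSpace Ω') (P' : Measure Ω'),
        IsProbabilityMeasure P' →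
        ∀ (ν' : Ω' → ℕ → ℕ) (τ : Ω' → Equiv.Perm (Fin (q j))),
        Measurable ν' →
        Measure.map ν' P' = Measure.map (ν (j - 1)) P →
        (∀ e, MeasurableSet {ω' | τ ω' = e}) →
        (∀ e : Equiv.Perm (Fin (q j)),
          P' {ω' | τ ω' = e} = 1 / (Nat.factorial (q j) : ℝ≥0∞)) →
        (∀ (e : Equiv.Perm (Fin (q j))) (S : Set (ℕ → ℕ)), MeasurableSet S →
          P' ({ω' | τ ω' = e} ∩ ν' ⁻¹' S)
            = P' {ω' | τ ω' = e} * P' (ν' ⁻¹' S)) →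
        P ({ω | coalX q T k (fun s => ν s ω) (σ ω) (j - 1) = m (j - 1)}
              ∩ {ω | coalX q T k (fun s => ν s ω) (σ ω) j = m j})
            / P {ω | coalX q T k (fun s => ν s ω) (σ ω) j = m j}
          = P' {ω' | ((Finset.range (m j)).image
                (fun i => parentMap (ν' ω') (permVal (τ ω') i))).card = m (j - 1)} := by
  classical
  have main := core P T q hq ν hνmeas hsum hexch σ hσmeas hσunif hindep k hkq m j hj1 hjT
  obtain ⟨hA, hsub, hL⟩ := main
  obtain ⟨s1, i1⟩ := hL (fun _ => True)
  obtain ⟨s2, i2⟩ := hL (fun l => l = j)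
  have E1 : {ω | ∀ l, True → j ≤ l → l ≤ T → coalX q T k (fun s => ν s ω) (σ ω) l = m l}
      = {ω | ∀ i, j ≤ i → i ≤ T → coalX q T k (fun s => ν s ω) (σ ω) i = m i} := by
    ext ω; simp
  have E2 : {ω | ∀ l, l = j → j ≤ l → l ≤ T → coalX q T k (fun s => ν s ω) (σ ω) l = m l}
      = {ω | coalX q T k (fun s => ν s ω) (σ ω) j = m j} := by
    ext ω; simp [hjT]
  simp only [E1] at s1 i1
  simp only [E2] at s2 i2
  have hX : {ω | coalX q T k (fun s => ν s ω) (σ ω) (j - 1) = m (j - 1)}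
      = {ω | ((ancSet q T k (fun s => ν s ω) (σ ω) j).image
          (parentMap (ν (j - 1) ω))).card = m (j - 1)} := by
    ext ω
    have := ancSet_succ q T k (fun s => ν s ω) (σ ω) (j - 1) (by omega)
    rw [show j - 1 + 1 = j by omega] at this
    simp only [Set.mem_ofPred_eq]
    rw [← this]
    rfl
  have hpos2 : P {ω | coalX q T k (fun s => ν s ω) (σ ω) j = m j} ≠ 0 := by
    refine (lt_of_lt_of_le hpos (measure_mono ?_)).ne'
    intro ω h
    exact h j le_rfl hjT
  have r1 := final_lemma P (ν (j - 1)) (hνmeas _) (q j) (m j) (m (j - 1)) _ hA hsub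
    {ω | ∀ i, j ≤ i → i ≤ T → coalX q T k (fun s => ν s ω) (σ ω) i = m i}
    (fun ω h => h j le_rfl hjT) hpos.ne' s1 i1
  have r2 := final_lemma P (ν (j - 1)) (hνmeas _) (q j) (m j) (m (j - 1)) _ hA hsub
    {ω | coalX q T k (fun s => ν s ω) (σ ω) j = m j} (fun ω h => h) hpos2 s2 i2
  rw [hX]
  refine ⟨r1.2.trans r2.2.symm, ?_⟩
  intro Ω' _ P' _ ν' τ hν' hmap hτ hunif hind
  rw [r2.2, ← hmap]
  have hmj := r2.1
  have base := fun (V : Set (ℕ → ℕ)) (hV : MeasurableSet V) =>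
    base_lemma P' (q j) (m j) hmj τ hτ hunif (ν' ⁻¹' V) (P' (ν' ⁻¹' V))
      (fun e => hind e V hV)
  have base0 := base_lemma P' (q j) (m j) hmj τ hτ hunif Set.univ 1 (by simp)
  have r3 := final_lemma P' ν' hν' (q j) (m j) (m (j - 1))
    (fun ω => (Finset.range (m j)).image (permVal (τ ω)))
    (meas_perm_image τ hτ _)
    (Filter.Eventually.of_forall fun ω x hx => by
      obtain ⟨i, _, rfl⟩ := Finset.mem_image.mp hx
      exact Finset.mem_range.mpr (permVal_lt (hq j hjT) _ _))
    Set.univ (fun ω _ => permVal_image_card hmj _) (by simp)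
    (fun B B' hB hB' hc => by simpa using base0 B B' hB hB' hc)
    (fun B hB V hV => by simpa using base V hV B B hB hB rfl)
  rw [← r3.2]
  simp only [Set.inter_univ, measure_univ, div_one, Finset.image_image]
  rfl
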